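/- Let μ be an Ising model on n spins with parameters θ*, the stationary distribution of a reversible Markov chain P on {−1,1}^n satisfying the bounded spin-flip condition with constant ω_P, and let ν be a strictly positive η-strongly metastable distribution of P. Fix a site u and let L_M(θ_u) = (1/M) Σ_{t=1}^M log(1 + exp(−2σ^(t)_u(Σ_{k≠u} θ_{uk} σ^(t)_k + θ_u))) be the empirical pseudo-likelihood loss on M i.i.d. samples σ^(1),…,σ^(M) from ν. If M ≥ (8/ε_a²) log(2n/δ_a), then with probability at least 1 − δ_a, ‖∇L_M(θ*_u)‖_∞ ≤ 4η/ω_P + ε_a. -/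

import Mathlib

open Finset

/-- The real spin value `±1` of a Boolean spin. -/
noncomputable def spin (b : Bool) : ℝ := if b then 1 else -1

/-- The Ising energy `E*(σ) = Σ_{i<j} J_{ij} σ_i σ_j + Σ_i h_i σ_i`. -/
noncomputable def isingEnergy {n : ℕ} (J : Fin n → Fin n → ℝ) (h : Fin n → ℝ)
    (σ : Fin n → Bool) : ℝ :=
  (∑ i : Fin n, ∑ j : Fin n, if i < j then J i j * spin (σ i) * spin (σ j) else 0) +
    ∑ i : Fin n, h i * spin (σ i)

/-- The Ising Gibbs distribution `μ(σ) ∝ exp(E*(σ))`. -/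
noncomputable def isingGibbs {n : ℕ} (J : Fin n → Fin n → ℝ) (h : Fin n → ℝ)
    (σ : Fin n → Bool) : ℝ :=
  Real.exp (isingEnergy J h σ) / ∑ σ' : Fin n → Bool, Real.exp (isingEnergy J h σ')

/-- Single-variable conditional `ν(q | σ_{∖u})` for a distribution on `{−1,1}^n`. -/
noncomputable def boolCond {n : ℕ} (ν : (Fin n → Bool) → ℝ) (σ : Fin n → Bool)
    (u : Fin n) (q : Bool) : ℝ :=
  ν (Function.update σ u q) / (ν (Function.update σ u true) + ν (Function.update σ u false))

/-- Site-`u` pseudo-likelihood loss for Ising models. -/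
noncomputable def plIsing {n : ℕ} (u : Fin n) (θh : ℝ) (θJ : Fin n → ℝ)
    (σ : Fin n → Bool) : ℝ :=
  Real.log (1 + Real.exp (-2 * spin (σ u) *
    ((∑ v ∈ Finset.univ.erase u, θJ v * spin (σ v)) + θh)))

/-- Empirical pseudo-likelihood loss at site `u` on `M` samples. -/
noncomputable def empPL {n M : ℕ} (ω : Fin M → (Fin n → Bool)) (u : Fin n)
    (θh : ℝ) (θJ : Fin n → ℝ) : ℝ :=
  (1 / (M : ℝ)) * ∑ t : Fin M, plIsing u θh θJ (ω t)

lemma aux_mgf {α : Type*} [Fintype α] (ν : α → ℝ) (hν : ∀ σ, 0 ≤ ν σ) (h1 : ∑ σ, ν σ = 1)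
    (g : α → ℝ) (hg : ∀ σ, |g σ| ≤ 2) (s : ℝ) :
    ∑ σ, ν σ * Real.exp (s * (g σ - ∑ τ, ν τ * g τ)) ≤ Real.exp (2 * s ^ 2) := by
  classical
  let _ : MeasurableSpace α := ⊤
  have : MeasurableSingletonClass α := ⟨fun _ => trivial⟩
  have hsum : ∑ a, ENNReal.ofReal (ν a) = 1 := by
    rw [← ENNReal.ofReal_sum_of_nonneg (fun i _ => hν i), h1, ENNReal.ofReal_one]
  let p : PMF α := PMF.ofFintype (fun a => ENNReal.ofReal (ν a)) hsum
  have hp : ∀ a, (p a).toReal = ν a := by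
    intro a
    simp [p, PMF.ofFintype_apply, ENNReal.toReal_ofReal (hν a)]
  have hm : AEMeasurable g p.toMeasure := (measurable_from_top).aemeasurable
  have key := ProbabilityTheory.hasSubgaussianMGF_of_mem_Icc (μ := p.toMeasure) (X := g)
    (a := -2) (b := 2) hm (Filter.Eventually.of_forall (fun σ => abs_le.mp (hg σ)))
  have h2 := key.mgf_le s
  rw [ProbabilityTheory.mgf, PMF.integral_eq_sum, PMF.integral_eq_sum] at h2
  simp only [hp, smul_eq_mul] at h2
  refine h2.trans (le_of_eq ?_)
  congr 1
  push_cast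
  norm_num
  ring

lemma aux_chernoff {α : Type*} [Fintype α] (ν : α → ℝ) (hν : ∀ σ, 0 ≤ ν σ) (h1 : ∑ σ, ν σ = 1)
    (g : α → ℝ) (hg : ∀ σ, |g σ| ≤ 2) (ε : ℝ) (M : ℕ) :
    ∑ ω : Fin M → α, (∏ t, ν (ω t)) *
      Real.exp (ε / 4 * (∑ t, (g (ω t) - ∑ τ, ν τ * g τ) - M * ε))
      ≤ Real.exp (-(M * ε ^ 2 / 8)) := by
  classical
  have h := aux_mgf ν hν h1 g hg (ε / 4)
  set m := ∑ τ, ν τ * g τ with hmdef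
  have h0 : 0 ≤ ∑ σ, ν σ * Real.exp (ε / 4 * (g σ - m)) :=
    Finset.sum_nonneg (fun σ _ => mul_nonneg (hν σ) (Real.exp_pos _).le)
  have hpow := pow_le_pow_left₀ h0 h M
  have e1 : (∑ σ, ν σ * Real.exp (ε / 4 * (g σ - m))) ^ M
      = ∑ ω : Fin M → α, ∏ t, (ν (ω t) * Real.exp (ε / 4 * (g (ω t) - m))) := by
    rw [Finset.sum_pow']
    simp
  have e2 : ∑ ω : Fin M → α, (∏ t, ν (ω t)) *
      Real.exp (ε / 4 * (∑ t, (g (ω t) - m) - M * ε))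
      = Real.exp (-(ε / 4 * (M * ε))) *
        ∑ ω : Fin M → α, ∏ t, (ν (ω t) * Real.exp (ε / 4 * (g (ω t) - m))) := by
    rw [Finset.mul_sum]
    refine Finset.sum_congr rfl (fun ω _ => ?_)
    rw [Finset.prod_mul_distrib, ← Real.exp_sum, ← Finset.mul_sum, mul_sub, sub_eq_add_neg,
      Real.exp_add]
    ring
  rw [e2, ← e1]
  refine (mul_le_mul_of_nonneg_left hpow (Real.exp_pos _).le).trans (le_of_eq ?_)
  rw [← Real.exp_nat_mul, ← Real.exp_add]
  congr 1
  ring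

lemma aux_spin_abs (b : Bool) : |spin b| = 1 := by
  cases b <;> simp [spin]

lemma aux_spin_not (b : Bool) : spin (!b) = - spin b := by
  cases b <;> simp [spin]

/-- Flip of the spin at `u`. -/
def auxFlip {n : ℕ} (u : Fin n) (σ : Fin n → Bool) : Fin n → Bool :=
  Function.update σ u (!σ u)

lemma auxFlip_invol {n : ℕ} (u : Fin n) : Function.Involutive (auxFlip u) := by
  intro σ
  simp [auxFlip]

/-- Local field at `u`. -/
noncomputable def auxField {n : ℕ} (J : Fin n → Fin n → ℝ) (h : Fin n → ℝ) (u : Fin n)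
    (σ : Fin n → Bool) : ℝ :=
  (∑ v ∈ Finset.univ.erase u, J u v * spin (σ v)) + h u

lemma aux_pair {n : ℕ} (J : Fin n → Fin n → ℝ)
    (hJsymm : ∀ i j, J i j = J j i) (hJdiag : ∀ i, J i i = 0) (a : Fin n → ℝ) :
    2 * (∑ i : Fin n, ∑ j : Fin n, if i < j then J i j * a i * a j else 0)
      = ∑ i : Fin n, ∑ j : Fin n, J i j * a i * a j := by
  have h2 : (∑ i : Fin n, ∑ j : Fin n, if i < j then J i j * a i * a j else 0)
      = ∑ i : Fin n, ∑ j : Fin n, if j < i then J i j * a i * a j else 0 := by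
    rw [Finset.sum_comm]
    refine Finset.sum_congr rfl (fun i _ => Finset.sum_congr rfl (fun j _ => ?_))
    rw [hJsymm j i]
    split_ifs <;> ring
  rw [two_mul]
  nth_rewrite 2 [h2]
  rw [← Finset.sum_add_distrib]
  refine Finset.sum_congr rfl (fun i _ => ?_)
  rw [← Finset.sum_add_distrib]
  refine Finset.sum_congr rfl (fun j _ => ?_)
  rcases lt_trichotomy i j with hij | hij | hij
  · simp [hij, hij.not_gt]
  · subst hij; simp [hJdiag]
  · simp [hij, hij.not_gt]

lemma aux_energy_flip {n : ℕ} (J : Fin n → Fin n → ℝ) (h : Fin n → ℝ)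
    (hJsymm : ∀ i j, J i j = J j i) (hJdiag : ∀ i, J i i = 0) (u : Fin n) (σ : Fin n → Bool) :
    isingEnergy J h (auxFlip u σ) = isingEnergy J h σ - 2 * spin (σ u) * auxField J h u σ := by
  have hs : ∀ i, spin (auxFlip u σ i) = spin (σ i) - (if i = u then 2 * spin (σ u) else 0) := by
    intro i
    by_cases hi : i = u
    · subst hi; simp [auxFlip, aux_spin_not]; ring
    · simp [auxFlip, hi]
  have p1 := aux_pair J hJsymm hJdiag (fun i => spin (auxFlip u σ i))
  have p2 := aux_pair J hJsymm hJdiag (fun i => spin (σ i))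
  have hf : ∑ v ∈ Finset.univ.erase u, J u v * spin (σ v) = ∑ v, J u v * spin (σ v) := by
    rw [← Finset.add_sum_erase Finset.univ _ (Finset.mem_univ u)]
    simp [hJdiag]
  have q1 : ∑ i : Fin n, h i * spin (auxFlip u σ i)
      = ∑ i : Fin n, h i * spin (σ i) - 2 * spin (σ u) * h u := by
    simp only [hs, mul_sub, Finset.sum_sub_distrib, mul_ite, mul_zero, Finset.sum_ite_eq',
      Finset.mem_univ, if_true]
    ring
  have q2 : ∑ i : Fin n, ∑ j : Fin n, J i j * spin (auxFlip u σ i) * spin (auxFlip u σ j)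
      = ∑ i : Fin n, ∑ j : Fin n, J i j * spin (σ i) * spin (σ j)
        - 4 * spin (σ u) * ∑ v, J u v * spin (σ v) := by
    have e : ∀ i j, J i j * spin (auxFlip u σ i) * spin (auxFlip u σ j)
        = J i j * spin (σ i) * spin (σ j)
          - (if i = u then 2 * spin (σ u) * (J u j * spin (σ j)) else 0)
          - (if j = u then 2 * spin (σ u) * (J u i * spin (σ i)) else 0) := by
      intro i j
      rw [hs, hs]
      by_cases hi : i = u <;> by_cases hj : j = u
      · subst hi; subst hj; simp [hJdiag]
      · subst hi; simp [hj]; ring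
      · subst hj; simp [hi]; rw [hJsymm i j]; ring
      · simp [hi, hj]
    simp only [e, Finset.sum_sub_distrib, Finset.sum_ite_eq', Finset.mem_univ, if_true]
    rw [Finset.sum_comm (f := fun i j => if i = u then 2 * spin (σ u) * (J u j * spin (σ j)) else 0)]
    simp only [Finset.sum_ite_eq', Finset.mem_univ, if_true, ← Finset.mul_sum]
    ring
  unfold isingEnergy auxField
  rw [hf, q1]
  linarith

/-- Conditional probability of the flipped spin. -/
noncomputable def auxC {n : ℕ} (J : Fin n → Fin n → ℝ) (h : Fin n → ℝ) (u : Fin n)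
    (σ : Fin n → Bool) : ℝ :=
  Real.exp (-2 * spin (σ u) * auxField J h u σ) /
    (1 + Real.exp (-2 * spin (σ u) * auxField J h u σ))

lemma auxC_pos {n : ℕ} (J : Fin n → Fin n → ℝ) (h : Fin n → ℝ) (u : Fin n)
    (σ : Fin n → Bool) : 0 < auxC J h u σ := by
  unfold auxC; positivity

lemma auxC_le {n : ℕ} (J : Fin n → Fin n → ℝ) (h : Fin n → ℝ) (u : Fin n)
    (σ : Fin n → Bool) : auxC J h u σ ≤ 1 := by
  unfold auxC
  rw [div_le_one (by positivity)]
  linarith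

lemma aux_gibbs_pos {n : ℕ} (J : Fin n → Fin n → ℝ) (h : Fin n → ℝ) (σ : Fin n → Bool) :
    0 < isingGibbs J h σ := by
  unfold isingGibbs
  exact div_pos (Real.exp_pos _)
    (Finset.sum_pos (fun _ _ => Real.exp_pos _) Finset.univ_nonempty)

lemma aux_cond {n : ℕ} (J : Fin n → Fin n → ℝ) (h : Fin n → ℝ)
    (hJsymm : ∀ i j, J i j = J j i) (hJdiag : ∀ i, J i i = 0) (u : Fin n) (σ : Fin n → Bool) :
    auxC J h u σ * (isingGibbs J h (auxFlip u σ) + isingGibbs J h σ)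
      = isingGibbs J h (auxFlip u σ) := by
  have e := aux_energy_flip J h hJsymm hJdiag u σ
  have hZ : 0 < ∑ σ' : Fin n → Bool, Real.exp (isingEnergy J h σ') :=
    (Finset.sum_pos (fun _ _ => Real.exp_pos _) Finset.univ_nonempty)
  unfold isingGibbs auxC
  rw [e, sub_eq_add_neg, Real.exp_add]
  have : -(2 * spin (σ u) * auxField J h u σ) = -2 * spin (σ u) * auxField J h u σ := by ring
  rw [this]
  have := Real.exp_pos (-2 * spin (σ u) * auxField J h u σ)
  field_simp
  ring

lemma aux_boolCond {n : ℕ} (μ : (Fin n → Bool) → ℝ) (u : Fin n) (σ : Fin n → Bool) :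
    boolCond μ σ u (!σ u) = μ (auxFlip u σ) / (μ (auxFlip u σ) + μ σ) := by
  unfold boolCond auxFlip
  have hself : Function.update σ u (σ u) = σ := Function.update_eq_self u σ
  cases hb : σ u
  · rw [hb] at hself; simp [hself]
  · rw [hb] at hself; simp [hself, add_comm]

lemma aux_expect {n : ℕ}
    (J : Fin n → Fin n → ℝ) (hfield : Fin n → ℝ)
    (hJsymm : ∀ i j, J i j = J j i) (hJdiag : ∀ i, J i i = 0)
    (μ : (Fin n → Bool) → ℝ) (hμ : ∀ σ, μ σ = isingGibbs J hfield σ)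
    (P : (Fin n → Bool) → (Fin n → Bool) → ℝ)
    (hrev : ∀ σ σ', P σ' σ * μ σ = P σ σ' * μ σ')
    (ωP : ℝ) (hωP : 0 < ωP)
    (hflip : ∀ (σ : Fin n → Bool) (u : Fin n) (q : Bool),
      P (Function.update σ u q) σ / boolCond μ σ u q ≥ ωP)
    (ν : (Fin n → Bool) → ℝ)
    (η : ℝ)
    (hmeta : (1 / 2) * ∑ σ, ∑ σ', |P σ' σ * ν σ - P σ σ' * ν σ'| ≤ η)
    (u : Fin n) (a : (Fin n → Bool) → ℝ) (ha : ∀ σ, |a σ| = 1)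
    (haf : ∀ σ, a (auxFlip u σ) = a σ) :
    |∑ σ, ν σ * (-2 * spin (σ u) * a σ * auxC J hfield u σ)| ≤ 4 * η / ωP := by
  have hμpos : ∀ σ, 0 < μ σ := fun σ => by rw [hμ]; exact aux_gibbs_pos _ _ _
  have hc : ∀ σ, auxC J hfield u σ = μ (auxFlip u σ) / (μ (auxFlip u σ) + μ σ) := by
    intro σ
    have h1 := hμpos σ
    have h2 := hμpos (auxFlip u σ)
    rw [eq_div_iff (by positivity), hμ, hμ]
    exact aux_cond J hfield hJsymm hJdiag u σ
  have hpt : ∀ σ, |ν σ * auxC J hfield u σ - ν (auxFlip u σ) * auxC J hfield u (auxFlip u σ)|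
      ≤ ωP⁻¹ * |P (auxFlip u σ) σ * ν σ - P σ (auxFlip u σ) * ν (auxFlip u σ)| := by
    intro σ
    have h1 := hμpos σ
    have h2 := hμpos (auxFlip u σ)
    have hr := hflip σ u (!σ u)
    rw [aux_boolCond] at hr
    change P (auxFlip u σ) σ / _ ≥ ωP at hr
    have hrv := hrev σ (auxFlip u σ)
    have hc1 := hc σ
    have hc2 := hc (auxFlip u σ)
    rw [auxFlip_invol u σ] at hc2
    rw [← hc1] at hr
    have hcp := auxC_pos J hfield u σ
    set r := P (auxFlip u σ) σ / auxC J hfield u σ with hrdef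
    have hP1 : P (auxFlip u σ) σ = r * auxC J hfield u σ := by
      rw [hrdef]; field_simp
    have hP2 : P σ (auxFlip u σ) = r * auxC J hfield u (auxFlip u σ) := by
      have : P σ (auxFlip u σ) = P (auxFlip u σ) σ * μ σ / μ (auxFlip u σ) := by
        rw [hrv]; field_simp
      rw [this, hP1, hc1, hc2, add_comm (μ σ)]
      field_simp
    rw [hP1, hP2]
    have e : r * auxC J hfield u σ * ν σ - r * auxC J hfield u (auxFlip u σ) * ν (auxFlip u σ)
      = r * (ν σ * auxC J hfield u σ - ν (auxFlip u σ) * auxC J hfield u (auxFlip u σ)) := by ring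
    have hrpos : 0 < r := lt_of_lt_of_le hωP hr
    rw [e, abs_mul, abs_of_pos hrpos, ← mul_assoc]
    refine le_mul_of_one_le_left (abs_nonneg _) ?_
    rw [inv_mul_eq_div, one_le_div hωP]
    exact hr
  set S := ∑ σ, ν σ * (-2 * spin (σ u) * a σ * auxC J hfield u σ) with hS
  have hS2 : S = ∑ σ, ν (auxFlip u σ) *
      (2 * spin (σ u) * a σ * auxC J hfield u (auxFlip u σ)) := by
    rw [hS, ← Equiv.sum_comp (auxFlip_invol u).toPerm]
    refine Finset.sum_congr rfl (fun σ _ => ?_)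
    simp only [Function.Involutive.coe_toPerm, haf]
    have : spin (auxFlip u σ u) = - spin (σ u) := by simp [auxFlip, aux_spin_not]
    rw [this]; ring
  have hS3 : S = ∑ σ, -(spin (σ u) * a σ) *
      (ν σ * auxC J hfield u σ - ν (auxFlip u σ) * auxC J hfield u (auxFlip u σ)) := by
    have : S = (S + S) / 2 := by ring
    rw [this]
    nth_rewrite 2 [hS2]
    rw [hS, ← Finset.sum_add_distrib, Finset.sum_div]
    refine Finset.sum_congr rfl (fun σ _ => ?_)
    ring
  have hb : |S| ≤ ωP⁻¹ * ∑ σ, ∑ σ', |P σ' σ * ν σ - P σ σ' * ν σ'| := by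
    rw [hS3, Finset.mul_sum]
    refine (Finset.abs_sum_le_sum_abs _ _).trans (Finset.sum_le_sum (fun σ _ => ?_))
    rw [abs_mul, abs_neg, abs_mul, aux_spin_abs, ha, one_mul, one_mul]
    refine (hpt σ).trans (mul_le_mul_of_nonneg_left ?_ (inv_pos.mpr hωP).le)
    exact Finset.single_le_sum (f := fun σ' => |P σ' σ * ν σ - P σ σ' * ν σ'|)
      (fun _ _ => abs_nonneg _) (Finset.mem_univ (auxFlip u σ))
  have hnn : 0 ≤ ∑ σ, ∑ σ', |P σ' σ * ν σ - P σ σ' * ν σ'| :=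
    Finset.sum_nonneg (fun _ _ => Finset.sum_nonneg (fun _ _ => abs_nonneg _))
  refine hb.trans ?_
  rw [inv_mul_eq_div]
  exact div_le_div_of_nonneg_right (by linarith) hωP.le

lemma aux_deriv_one (s a F c : ℝ) :
    HasDerivAt (fun t : ℝ => Real.log (1 + Real.exp (-2 * s * (F + (t - c) * a))))
      (-2 * s * a * (Real.exp (-2 * s * F) / (1 + Real.exp (-2 * s * F)))) c := by
  have h1 : HasDerivAt (fun t : ℝ => -2 * s * (F + (t - c) * a)) (-2 * s * (1 * a)) c :=
    ((((hasDerivAt_id c).sub_const c).mul_const a).const_add F).const_mul (-2 * s)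
  have h2 := ((h1.exp).const_add 1).log (by positivity)
  simp only [sub_self, zero_mul, add_zero] at h2
  convert h2 using 1
  ring

lemma aux_deriv_field {n M : ℕ} (J : Fin n → Fin n → ℝ) (h : Fin n → ℝ) (u : Fin n)
    (ω : Fin M → (Fin n → Bool)) :
    deriv (fun t : ℝ => empPL ω u t (fun v => J u v)) (h u)
      = (1 / (M : ℝ)) * ∑ t, (-2 * spin (ω t u) * 1 * auxC J h u (ω t)) := by
  apply HasDerivAt.deriv
  unfold empPL
  apply HasDerivAt.const_mul
  apply HasDerivAt.fun_sum
  intro i _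
  have := aux_deriv_one (spin (ω i u)) 1 (auxField J h u (ω i)) (h u)
  convert! this using 1
  funext t
  unfold plIsing auxField
  congr 4
  ring

lemma aux_deriv_pair {n M : ℕ} (J : Fin n → Fin n → ℝ) (h : Fin n → ℝ) (u k : Fin n)
    (hk : k ≠ u) (ω : Fin M → (Fin n → Bool)) :
    deriv (fun t : ℝ => empPL ω u (h u) (Function.update (fun v => J u v) k t)) (J u k)
      = (1 / (M : ℝ)) * ∑ t, (-2 * spin (ω t u) * spin (ω t k) * auxC J h u (ω t)) := by
  apply HasDerivAt.deriv
  unfold empPL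
  apply HasDerivAt.const_mul
  apply HasDerivAt.fun_sum
  intro i _
  have := aux_deriv_one (spin (ω i u)) (spin (ω i k)) (auxField J h u (ω i)) (J u k)
  convert! this using 1
  funext t
  unfold plIsing auxField
  have hmem : k ∈ Finset.univ.erase u := by simp [hk]
  have e : ∑ v ∈ Finset.univ.erase u, Function.update (fun v => J u v) k t v * spin (ω i v)
      = ∑ v ∈ Finset.univ.erase u, J u v * spin (ω i v) + (t - J u k) * spin (ω i k) := by
    rw [← Finset.add_sum_erase _ _ hmem,
      ← Finset.add_sum_erase _ (fun v => J u v * spin (ω i v)) hmem]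
    have : ∑ v ∈ (Finset.univ.erase u).erase k,
        Function.update (fun v => J u v) k t v * spin (ω i v)
        = ∑ v ∈ (Finset.univ.erase u).erase k, J u v * spin (ω i v) := by
      refine Finset.sum_congr rfl (fun v hv => ?_)
      rw [Function.update_of_ne (Finset.ne_of_mem_erase hv)]
    rw [this]
    simp
    ring
  rw [e]
  congr 4
  ring

/-- **Gradient of the empirical PL loss is small at the true parameters.** -/
theorem empirical_pl_gradient_small {n : ℕ}
    (J : Fin n → Fin n → ℝ) (hfield : Fin n → ℝ)
    (hJsymm : ∀ i j, J i j = J j i) (hJdiag : ∀ i, J i i = 0)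
    (μ : (Fin n → Bool) → ℝ) (hμ : ∀ σ, μ σ = isingGibbs J hfield σ)
    (P : (Fin n → Bool) → (Fin n → Bool) → ℝ)
    (hP0 : ∀ σ σ', 0 ≤ P σ' σ) (hP1 : ∀ σ, ∑ σ', P σ' σ = 1)
    (hrev : ∀ σ σ', P σ' σ * μ σ = P σ σ' * μ σ')
    (ωP : ℝ) (hωP : 0 < ωP)
    (hflip : ∀ (σ : Fin n → Bool) (u : Fin n) (q : Bool),
      P (Function.update σ u q) σ / boolCond μ σ u q ≥ ωP)
    (ν : (Fin n → Bool) → ℝ) (hνpos : ∀ σ, 0 < ν σ) (hν1 : ∑ σ, ν σ = 1)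
    (η : ℝ)
    (hmeta : (1 / 2) * ∑ σ, ∑ σ', |P σ' σ * ν σ - P σ σ' * ν σ'| ≤ η)
    (u : Fin n)
    (εa δa : ℝ) (hεa : 0 < εa) (hδa0 : 0 < δa) (hδa1 : δa < 1)
    (M : ℕ) (hM : (M : ℝ) ≥ 8 / εa ^ 2 * Real.log (2 * n / δa)) :
    ∑ ω : Fin M → (Fin n → Bool),
      Set.indicator
        {ω : Fin M → (Fin n → Bool) |
          (∀ k : Fin n, k ≠ u →
            |deriv (fun t : ℝ =>
                empPL ω u (hfield u) (Function.update (fun v => J u v) k t)) (J u k)|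
              ≤ 4 * η / ωP + εa) ∧
          |deriv (fun t : ℝ => empPL ω u t (fun v => J u v)) (hfield u)| ≤ 4 * η / ωP + εa}
        (fun ω => ∏ t : Fin M, ν (ω t)) ω
      ≥ 1 - δa := by
  classical
  set B := 4 * η / ωP with hB
  -- direction multiplier
  let a : Fin n → (Fin n → Bool) → ℝ := fun k σ => if k = u then 1 else spin (σ k)
  have ha : ∀ k σ, |a k σ| = 1 := by
    intro k σ
    by_cases hk : k = u
    · simp [a, hk]
    · simp [a, hk, aux_spin_abs]
  have haf : ∀ k σ, a k (auxFlip u σ) = a k σ := by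
    intro k σ
    by_cases hk : k = u
    · simp [a, hk]
    · simp [a, hk, auxFlip]
  let g : Fin n → (Fin n → Bool) → ℝ := fun k σ =>
    -2 * spin (σ u) * a k σ * auxC J hfield u σ
  have hg : ∀ k σ, |g k σ| ≤ 2 := by
    intro k σ
    simp only [g, abs_mul, aux_spin_abs, ha, abs_of_pos (auxC_pos J hfield u σ)]
    have := auxC_le J hfield u σ
    norm_num
    linarith
  let m : Fin n → ℝ := fun k => ∑ σ, ν σ * g k σ
  have hm : ∀ k, |m k| ≤ B := fun k =>
    aux_expect J hfield hJsymm hJdiag μ hμ P hrev ωP hωP hflip ν η hmeta u (a k) (ha k) (haf k)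
  have hn : (1 : ℝ) ≤ n := by
    have : 0 < n := u.pos
    exact_mod_cast this
  have hlog : 0 < Real.log (2 * n / δa) := by
    apply Real.log_pos
    rw [lt_div_iff₀ hδa0]
    linarith
  have hMpos : (0 : ℝ) < M := lt_of_lt_of_le (by positivity) hM
  have hν0 : ∀ σ, 0 ≤ ν σ := fun σ => (hνpos σ).le
  -- tail sums
  let X : Fin n → (Fin M → (Fin n → Bool)) → ℝ := fun k ω =>
    Real.exp (εa / 4 * (∑ t, (g k (ω t) - m k) - M * εa))
  let Y : Fin n → (Fin M → (Fin n → Bool)) → ℝ := fun k ω =>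
    Real.exp (εa / 4 * (∑ t, (-g k (ω t) - -m k) - M * εa))
  let W : (Fin M → (Fin n → Bool)) → ℝ := fun ω => ∏ t, ν (ω t)
  have hW0 : ∀ ω, 0 ≤ W ω := fun ω => Finset.prod_nonneg (fun _ _ => hν0 _)
  have hX : ∀ k, ∑ ω, W ω * X k ω ≤ Real.exp (-(M * εa ^ 2 / 8)) := fun k =>
    aux_chernoff ν hν0 hν1 (g k) (hg k) εa M
  have hY : ∀ k, ∑ ω, W ω * Y k ω ≤ Real.exp (-(M * εa ^ 2 / 8)) := by
    intro k
    have := aux_chernoff ν hν0 hν1 (fun σ => -g k σ) (fun σ => by simpa using hg k σ) εa M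
    simpa only [mul_neg, Finset.sum_neg_distrib] using this
  have hE : Real.exp (-(M * εa ^ 2 / 8)) ≤ δa / (2 * n) := by
    have h1 : Real.log (2 * n / δa) ≤ M * εa ^ 2 / 8 := by
      have h2 := mul_le_mul_of_nonneg_right hM (show 0 ≤ εa ^ 2 / 8 by positivity)
      have h3 : 8 / εa ^ 2 * Real.log (2 * n / δa) * (εa ^ 2 / 8) = Real.log (2 * n / δa) := by
        field_simp
      linarith
    calc Real.exp (-(M * εa ^ 2 / 8)) ≤ Real.exp (-Real.log (2 * n / δa)) :=
          Real.exp_le_exp.mpr (by linarith)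
      _ = δa / (2 * n) := by
          rw [Real.exp_neg, Real.exp_log (by positivity), inv_div]
  have hW1 : ∑ ω, W ω = 1 := by
    have : ∑ ω, W ω = (∑ σ, ν σ) ^ M := by
      rw [Finset.sum_pow']
      simp [W]
    rw [this, hν1, one_pow]
  -- a good coordinate
  have hgood : ∀ k ω, X k ω < 1 → Y k ω < 1 →
      |(1 / (M : ℝ)) * ∑ t, g k (ω t)| ≤ B + εa := by
    intro k ω hx hy
    have h4 : 0 < εa / 4 := by positivity
    have hx' := Real.exp_lt_one_iff.mp hx
    have hy' := Real.exp_lt_one_iff.mp hy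
    have hx2 : ∑ t, (g k (ω t) - m k) - M * εa < 0 := by
      by_contra hcon
      exact absurd (mul_nonneg h4.le (not_lt.mp hcon)) (not_le.mpr hx')
    have hy2 : ∑ t, (-g k (ω t) - -m k) - M * εa < 0 := by
      by_contra hcon
      exact absurd (mul_nonneg h4.le (not_lt.mp hcon)) (not_le.mpr hy')
    simp only [Finset.sum_sub_distrib, Finset.sum_neg_distrib, Finset.sum_const,
      Finset.card_univ, Fintype.card_fin, nsmul_eq_mul] at hx2 hy2
    have hmk := abs_le.mp (hm k)
    rw [abs_mul, abs_of_pos (by positivity), one_div, inv_mul_eq_div, div_le_iff₀ hMpos, abs_le]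
    constructor <;> nlinarith [mul_le_mul_of_nonneg_left hmk.1 hMpos.le,
      mul_le_mul_of_nonneg_left hmk.2 hMpos.le]
  have hpt : ∀ ω : Fin M → (Fin n → Bool), W ω - ∑ k, (W ω * X k ω + W ω * Y k ω) ≤
      Set.indicator
        {ω : Fin M → (Fin n → Bool) |
          (∀ k : Fin n, k ≠ u →
            |deriv (fun t : ℝ =>
                empPL ω u (hfield u) (Function.update (fun v => J u v) k t)) (J u k)|
              ≤ B + εa) ∧
          |deriv (fun t : ℝ => empPL ω u t (fun v => J u v)) (hfield u)| ≤ B + εa}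
        (fun ω => ∏ t : Fin M, ν (ω t)) ω := by
    intro ω
    have hterm : ∀ k, 0 ≤ W ω * X k ω + W ω * Y k ω := fun k =>
      add_nonneg (mul_nonneg (hW0 ω) (Real.exp_pos _).le)
        (mul_nonneg (hW0 ω) (Real.exp_pos _).le)
    by_cases hall : ∀ k, X k ω < 1 ∧ Y k ω < 1
    · rw [Set.indicator_of_mem]
      · have := Finset.sum_nonneg (fun k (_ : k ∈ Finset.univ) => hterm k)
        change W ω - _ ≤ W ω
        linarith
      · refine ⟨fun k hk => ?_, ?_⟩
        · rw [aux_deriv_pair J hfield u k hk ω]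
          have := hgood k ω (hall k).1 (hall k).2
          simpa only [g, a, hk, if_false] using this
        · rw [aux_deriv_field J hfield u ω]
          have := hgood u ω (hall u).1 (hall u).2
          simpa only [g, a, if_true] using this
    · push Not at hall
      obtain ⟨k, hk⟩ := hall
      refine le_trans ?_ (Set.indicator_nonneg (fun ω _ => hW0 ω) ω)
      have h1 := Finset.single_le_sum (f := fun k => W ω * X k ω + W ω * Y k ω)
        (fun k _ => hterm k) (Finset.mem_univ k)
      have hx0 : 0 < X k ω := Real.exp_pos _
      have hy0 : 0 < Y k ω := Real.exp_pos _
      have h2 : 1 ≤ X k ω + Y k ω := by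
        by_cases hx : X k ω < 1
        · have := hk hx; linarith
        · linarith [not_lt.mp hx]
      have := mul_le_mul_of_nonneg_left h2 (hW0 ω)
      linarith
  refine le_trans ?_ (Finset.sum_le_sum (fun ω _ => hpt ω))
  rw [Finset.sum_sub_distrib, hW1, Finset.sum_comm]
  have hfin : ∑ k : Fin n, ∑ ω, (W ω * X k ω + W ω * Y k ω) ≤ ∑ k : Fin n, δa / n := by
    refine Finset.sum_le_sum (fun k _ => ?_)
    rw [Finset.sum_add_distrib]
    have e : δa / n = δa / (2 * n) + δa / (2 * n) := by field_simp; ring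
    rw [e]
    exact add_le_add ((hX k).trans hE) ((hY k).trans hE)
  have hfin2 : ∑ k : Fin n, δa / n = δa := by
    rw [Finset.sum_const, Finset.card_univ, Fintype.card_fin, nsmul_eq_mul]
    field_simp
  linarith
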